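/- Let n be a positive integer, k ≥ 0, x₁, …, x_n ∈ ℝ³, and v ∈ ℂ^n. Define φ : ℝ → ℝ by φ(0) = 1 and φ(t) = sin(t)/t for t ≠ 0. Then the quadratic form Σ_{i=1}^n Σ_{j=1}^n conj(v_i) v_j φ(k ‖x_i − x_j‖) is a real number and is nonnegative. Equivalently, the n×n Hermitian matrix with entries φ(k‖x_i − x_j‖) is positive semidefinite. -/

import Mathlib

open MeasureTheory Metric

/-- `ℝ³` split orthogonally as an axis and a plane. -/
abbrev AxisPlane : Type := WithLp 2 (ℝ × EuclideanSpace ℝ (Fin 2))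

lemma integrableOn_cos_inner_ball {E : Type*} [NormedAddCommGroup E] [InnerProductSpace ℝ E]
    [FiniteDimensional ℝ E] [MeasurableSpace E] [BorelSpace E] (w : E) (R : ℝ) :
    IntegrableOn (fun y => Real.cos (inner ℝ w y)) (ball (0 : E) R) := by
  have hc : Continuous fun y : E => Real.cos (inner ℝ w y) := by fun_prop
  exact (hc.continuousOn.integrableOn_compact (isCompact_closedBall 0 R)).mono_set
    ball_subset_closedBall

/-- The integral of a plane wave over a ball depends only on the norm of the wave vector. -/
lemma integral_cos_inner_ball_congr {E : Type*} [NormedAddCommGroup E] [InnerProductSpace ℝ E]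
    [FiniteDimensional ℝ E] [MeasurableSpace E] [BorelSpace E] {w w' : E} (h : ‖w‖ = ‖w'‖)
    (R : ℝ) :
    ∫ y in ball (0 : E) R, Real.cos (inner ℝ w y) =
      ∫ y in ball (0 : E) R, Real.cos (inner ℝ w' y) := by
  set f : E ≃ₗᵢ[ℝ] E := (ℝ ∙ (w - w'))ᗮ.reflection
  have hf : f w = w' := Submodule.reflection_sub h
  rw [← f.measurePreserving.setIntegral_preimage_emb f.toHomeomorph.measurableEmbedding
    (fun y => Real.cos (inner ℝ w' y))]
  simp [← hf]

/-- Slicing the ball by planes orthogonal to the axis. -/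
lemma integral_cos_axis_ball (s : ℝ) {R : ℝ} (hR : 0 ≤ R) :
    ∫ y in ball (0 : AxisPlane) R, Real.cos (inner ℝ (WithLp.toLp 2 (s, 0)) y) =
      ∫ t in -R..R, Real.pi * (R ^ 2 - t ^ 2) * Real.cos (s * t) := by
  have hmp := WithLp.volume_preserving_symm_measurableEquiv_toLp_prod ℝ (EuclideanSpace ℝ (Fin 2))
  set D : Set (ℝ × EuclideanSpace ℝ (Fin 2)) := {p | p.1 ^ 2 + ‖p.2‖ ^ 2 < R ^ 2} with hD
  have hDm : MeasurableSet D := by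
    refine (isOpen_lt ?_ ?_).measurableSet <;> fun_prop
  have hpre : (MeasurableEquiv.toLp 2 (ℝ × EuclideanSpace ℝ (Fin 2))).symm ⁻¹' D =
      ball (0 : AxisPlane) R := by
    ext y
    rw [mem_ball_zero_iff, ← sq_lt_sq₀ (norm_nonneg _) hR, WithLp.prod_norm_sq_eq_of_L2]
    simp [hD]
  have hcos : ∀ y : AxisPlane, Real.cos (inner ℝ (WithLp.toLp 2 (s, 0)) y) =
      (fun p : ℝ × EuclideanSpace ℝ (Fin 2) => Real.cos (s * p.1))
        ((MeasurableEquiv.toLp 2 (ℝ × EuclideanSpace ℝ (Fin 2))).symm y) := by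
    intro y
    simp [WithLp.prod_inner_apply, mul_comm]
  have hint : IntegrableOn (fun p : ℝ × EuclideanSpace ℝ (Fin 2) => Real.cos (s * p.1)) D := by
    rw [← hmp.integrableOn_comp_preimage (MeasurableEquiv.measurableEmbedding _), hpre]
    exact (integrableOn_cos_inner_ball _ R).congr_fun (fun y _ => hcos y) measurableSet_ball
  have hslice : ∀ t : ℝ, ∫ z, D.indicator (fun p => Real.cos (s * p.1)) (t, z) =
      (Set.Ioc (-R) R).indicator
        (fun t => Real.pi * (R ^ 2 - t ^ 2) * Real.cos (s * t)) t := by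
    intro t
    have h1 : ∀ z : EuclideanSpace ℝ (Fin 2), D.indicator (fun p => Real.cos (s * p.1)) (t, z) =
        (ball (0 : EuclideanSpace ℝ (Fin 2)) (√(R ^ 2 - t ^ 2))).indicator
          (fun _ => Real.cos (s * t)) z := by
      intro z
      refine Set.indicator_eq_indicator ?_ rfl
      rw [mem_ball_zero_iff, Real.lt_sqrt (norm_nonneg _), lt_sub_iff_add_lt']
      rfl
    simp_rw [h1]
    rw [integral_indicator_const _ measurableSet_ball, measureReal_def,
      EuclideanSpace.volume_ball_fin_two, ENNReal.toReal_mul, ENNReal.toReal_pow,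
      ENNReal.toReal_ofReal (Real.sqrt_nonneg _), ENNReal.toReal_ofReal Real.pi_nonneg]
    by_cases ht : t ∈ Set.Ioc (-R) R
    · rw [Set.indicator_of_mem ht, Real.sq_sqrt (by nlinarith [ht.1, ht.2]), smul_eq_mul]
      ring
    · rw [Set.indicator_of_notMem ht, Real.sqrt_eq_zero_of_nonpos]
      · simp
      · by_contra! hlt
        have := abs_lt_of_sq_lt_sq' (sub_pos.1 hlt) hR
        exact ht ⟨this.1, this.2.le⟩
  simp_rw [hcos]
  rw [← hpre, hmp.setIntegral_preimage_emb (MeasurableEquiv.measurableEmbedding _)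
      (fun p => Real.cos (s * p.1)),
    ← integral_indicator hDm, Measure.volume_eq_prod,
    integral_prod _ ((integrable_indicator_iff hDm).2 hint)]
  simp_rw [hslice]
  rw [integral_indicator measurableSet_Ioc, intervalIntegral.integral_of_le (by linarith)]

/-- The derivative in the radius of the sliced integral, at radius one. -/
lemma hasDerivAt_sliced_integral {φ : ℝ → ℝ} (hφ0 : φ 0 = 1)
    (hφ : ∀ t : ℝ, t ≠ 0 → φ t = Real.sin t / t) (s : ℝ) :
    HasDerivAt (fun R : ℝ => ∫ t in -R..R, Real.pi * (R ^ 2 - t ^ 2) * Real.cos (s * t))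
      (4 * Real.pi * φ s) 1 := by
  rcases eq_or_ne s 0 with rfl | hs
  · have heq : (fun R : ℝ => ∫ t in -R..R, Real.pi * (R ^ 2 - t ^ 2) * Real.cos (0 * t)) =
        fun R => 4 / 3 * Real.pi * R ^ 3 := by
      funext R
      simp [intervalIntegral.integral_const_mul]
      ring
    rw [heq, hφ0]
    convert! (hasDerivAt_pow 3 (1 : ℝ)).const_mul (4 / 3 * Real.pi) using 1
    norm_num
    ring
  · have heq : (fun R : ℝ => ∫ t in -R..R, Real.pi * (R ^ 2 - t ^ 2) * Real.cos (s * t)) =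
        fun R => 4 * Real.pi / s ^ 3 * (Real.sin (s * R) - s * R * Real.cos (s * R)) := by
      funext R
      have hd : ∀ t : ℝ, HasDerivAt (fun t => Real.pi * ((R ^ 2 - t ^ 2) * Real.sin (s * t) / s
          - 2 * t * Real.cos (s * t) / s ^ 2 + 2 * Real.sin (s * t) / s ^ 3))
          (Real.pi * (R ^ 2 - t ^ 2) * Real.cos (s * t)) t := by
        intro t
        have hl : HasDerivAt (fun t => s * t) s t := by
          simpa using (hasDerivAt_id t).const_mul s
        have hsin := hl.sin
        have hcos := hl.cos
        have hq : HasDerivAt (fun t => R ^ 2 - t ^ 2) (-(2 * t)) t := by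
          simpa using (hasDerivAt_pow 2 t).const_sub (R ^ 2)
        have h2 : HasDerivAt (fun t : ℝ => 2 * t) 2 t := by
          simpa using (hasDerivAt_id t).const_mul (2 : ℝ)
        convert! ((((hq.mul hsin).div_const s).sub ((h2.mul hcos).div_const (s ^ 2))).add
          ((hsin.const_mul 2).div_const (s ^ 3))).const_mul Real.pi using 1
        field_simp
        ring
      rw [intervalIntegral.integral_eq_sub_of_hasDerivAt (fun t _ => hd t)
        (Continuous.intervalIntegrable (by fun_prop) _ _)]
      simp only [mul_neg, Real.sin_neg, Real.cos_neg]
      field_simp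
      ring
    rw [heq, hφ s hs]
    have hl : HasDerivAt (fun t => s * t) s 1 := by
      simpa using (hasDerivAt_id (1 : ℝ)).const_mul s
    convert! (hl.sin.sub (hl.mul hl.cos)).const_mul (4 * Real.pi / s ^ 3) using 1
    field_simp
    ring

/-- The cosine kernel is positive semidefinite. -/
lemma sum_re_mul_cos_sub_nonneg {n : ℕ} (v : Fin n → ℂ) (a : Fin n → ℝ) :
    0 ≤ ∑ i, ∑ j, ((starRingEnd ℂ) (v i) * v j).re * Real.cos (a i - a j) := by
  have h : ∑ i, ∑ j, ((starRingEnd ℂ) (v i) * v j).re * Real.cos (a i - a j) =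
      (∑ i, (v i).re * Real.cos (a i)) ^ 2 + (∑ i, (v i).im * Real.cos (a i)) ^ 2 +
      (∑ i, (v i).re * Real.sin (a i)) ^ 2 + (∑ i, (v i).im * Real.sin (a i)) ^ 2 := by
    simp only [sq, Finset.sum_mul_sum, ← Finset.sum_add_distrib]
    refine Finset.sum_congr rfl fun i _ => Finset.sum_congr rfl fun j _ => ?_
    rw [Real.cos_sub, Complex.mul_re, Complex.conj_re, Complex.conj_im]
    ring
  rw [h]
  positivity

/-- The real quadratic form of the sinc kernel is nonnegative. -/
lemma sum_re_mul_sinc_nonneg {n : ℕ} (x : Fin n → AxisPlane) (v : Fin n → ℂ) {φ : ℝ → ℝ}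
    (hφ0 : φ 0 = 1) (hφ : ∀ t : ℝ, t ≠ 0 → φ t = Real.sin t / t) :
    0 ≤ ∑ i, ∑ j, ((starRingEnd ℂ) (v i) * v j).re * φ ‖x i - x j‖ := by
  set Q : ℝ → ℝ := fun R => ∑ i, ∑ j, ((starRingEnd ℂ) (v i) * v j).re *
    ∫ t in -R..R, Real.pi * (R ^ 2 - t ^ 2) * Real.cos (‖x i - x j‖ * t) with hQ
  have hint : ∀ R i j, IntegrableOn (fun y => ((starRingEnd ℂ) (v i) * v j).re *
      Real.cos (inner ℝ (x i - x j) y)) (ball (0 : AxisPlane) R) := fun R i j =>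
    (integrableOn_cos_inner_ball (x i - x j) R).const_mul _
  have hQ' : ∀ R, 0 ≤ R → Q R = ∫ y in ball (0 : AxisPlane) R,
      ∑ i, ∑ j, ((starRingEnd ℂ) (v i) * v j).re * Real.cos (inner ℝ (x i - x j) y) := by
    intro R hR
    rw [integral_finsetSum _ fun i _ => integrable_finsetSum _ fun j _ => hint R i j]
    refine Finset.sum_congr rfl fun i _ => ?_
    rw [integral_finsetSum _ fun j _ => hint R i j]
    refine Finset.sum_congr rfl fun j _ => ?_
    rw [integral_const_mul, ← integral_cos_axis_ball _ hR]
    congr 1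
    refine integral_cos_inner_ball_congr ?_ R
    simp
  have hmono : MonotoneOn Q (Set.Ici 0) := by
    intro a ha b hb hab
    rw [hQ' a ha, hQ' b hb]
    refine setIntegral_mono_set
      (integrable_finsetSum _ fun i _ => integrable_finsetSum _ fun j _ => hint b i j)
      (.of_forall fun y => ?_) (ball_subset_ball hab).eventuallyLE
    simpa only [inner_sub_left, Pi.zero_apply] using
      sum_re_mul_cos_sub_nonneg v fun i => inner ℝ (x i) y
  have hderiv : HasDerivAt Q (∑ i, ∑ j, ((starRingEnd ℂ) (v i) * v j).re *
      (4 * Real.pi * φ ‖x i - x j‖)) 1 :=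
    HasDerivAt.fun_sum fun i _ => HasDerivAt.fun_sum fun j _ =>
      (hasDerivAt_sliced_integral hφ0 hφ ‖x i - x j‖).const_mul _
  have hnn := hmono.derivWithin_nonneg (x := 1)
  rw [hderiv.hasDerivWithinAt.derivWithin (uniqueDiffOn_Ici 0 1 (by simp))] at hnn
  simp only [mul_left_comm _ (4 * Real.pi), ← Finset.mul_sum] at hnn
  exact nonneg_of_mul_nonneg_right hnn (by positivity)

/-- Positive semidefiniteness of the sinc (radiation) kernel: for points
`x₁,…,x_n ∈ ℝ³`, `k ≥ 0` and `v ∈ ℂⁿ`, the quadratic form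
`Σᵢⱼ conj(vᵢ) vⱼ φ(k‖xᵢ−xⱼ‖)` (with `φ(0)=1`, `φ(t)=sin t / t`) is real and
nonnegative. -/
theorem sinc_kernel_posSemidef
    (n : ℕ) (hn : 0 < n) (k : ℝ) (hk : 0 ≤ k)
    (x : Fin n → EuclideanSpace ℝ (Fin 3)) (v : Fin n → ℂ)
    (φ : ℝ → ℝ) (hφ0 : φ 0 = 1) (hφ : ∀ t : ℝ, t ≠ 0 → φ t = Real.sin t / t) :
    (∑ i, ∑ j, (starRingEnd ℂ) (v i) * v j *
        ((φ (k * ‖x i - x j‖) : ℝ) : ℂ)).im = 0 ∧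
      0 ≤ (∑ i, ∑ j, (starRingEnd ℂ) (v i) * v j *
        ((φ (k * ‖x i - x j‖) : ℝ) : ℂ)).re := by
  have hdim : Module.finrank ℝ AxisPlane = 3 := by
    rw [(WithLp.linearEquiv 2 ℝ (ℝ × EuclideanSpace ℝ (Fin 2))).finrank_eq, Module.finrank_prod]
    simp
  let f : EuclideanSpace ℝ (Fin 3) ≃ₗᵢ[ℝ] AxisPlane :=
    ((stdOrthonormalBasis ℝ AxisPlane).reindex (finCongr hdim)).repr.symm
  constructor
  · have hc : (starRingEnd ℂ) (∑ i, ∑ j, (starRingEnd ℂ) (v i) * v j *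
        ((φ (k * ‖x i - x j‖) : ℝ) : ℂ)) = ∑ i, ∑ j, (starRingEnd ℂ) (v i) * v j *
        ((φ (k * ‖x i - x j‖) : ℝ) : ℂ) := by
      simp only [map_sum, map_mul, Complex.conj_conj, Complex.conj_ofReal]
      rw [Finset.sum_comm]
      refine Finset.sum_congr rfl fun i _ => Finset.sum_congr rfl fun j _ => ?_
      rw [norm_sub_rev, mul_comm (v j)]
    exact Complex.conj_eq_iff_im.1 hc
  · simp only [Complex.re_sum, Complex.re_mul_ofReal]
    convert! sum_re_mul_sinc_nonneg (fun i => f (k • x i)) v hφ0 hφ using 7 with i _ j _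
    rw [← map_sub, f.norm_map, ← smul_sub, norm_smul, Real.norm_of_nonneg hk]
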